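/- arXiv:2105.07765 — 2 statements merged into one kernel-verified Lean document; each statement's English description precedes it below -/
import Mathlib

section
/- Let f : ℝ^n → ℝ be twice continuously differentiable, x, s ∈ ℝ^n, L ≥ 0, θ₂ ≥ 1, 0 < σ ≤ σ_max, ε₂ > 0, and suppose: (i) ‖∇²f(x+s) − ∇²f(x)‖₂ ≤ L N(s), where ‖·‖₂ denotes the spectral (operator Euclidean) norm; (ii) λ_min[∇²f(x)] + θ₂ κ_ω σ N(s) ≥ 0, where κ_ω := 1 + 2/√3; (iii) λ_min[∇²f(x+s)] < −ε₂. Then N(s) ≥ ε₂ / (L + θ₂ κ_ω σ_max). -/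
open scoped RealInnerProductSpace

noncomputable section

/-- Abbreviation for the Euclidean space `ℝ^n`. -/
abbrev E (n : ℕ) := EuclideanSpace ℝ (Fin n)

/-- `N` is a norm on `ℝ^n` (possibly non-smooth, e.g. `ℓ¹` or `ℓ∞`). -/
structure IsNorm (n : ℕ) (N : E n → ℝ) : Prop where
  add_le : ∀ x y, N (x + y) ≤ N x + N y
  smul : ∀ (c : ℝ) (x : E n), N (c • x) = |c| * N x
  eq_zero : ∀ x, N x = 0 → x = 0

/-- The dual norm `‖v‖_{N,1} := max_{N s = 1} ⟪v, s⟫`. -/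
def dualNorm (n : ℕ) (N : E n → ℝ) (v : E n) : ℝ :=
  sSup {t : ℝ | ∃ s, N s = 1 ∧ t = ⟪v, s⟫}

/-- The smallest eigenvalue of a symmetric operator `A`, as the infimum of the
Rayleigh quotient over the Euclidean unit sphere. -/
def lamMin (n : ℕ) (A : E n →L[ℝ] E n) : ℝ :=
  sInf {t : ℝ | ∃ v : E n, ‖v‖ = 1 ∧ t = ⟪A v, v⟫}

/-- The norm `‖H‖_{N,2} := max_{N s = 1} |⟪H s, s⟫|` of a symmetric operator induced by `N`. -/
def matNormN (n : ℕ) (N : E n → ℝ) (A : E n →L[ℝ] E n) : ℝ :=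
  sSup {t : ℝ | ∃ v : E n, N v = 1 ∧ t = |⟪A v, v⟫|}

/-- The regularized quadratic model
`m(s) = f₀ + ⟪g,s⟫ + (1/2)⟪Hs,s⟫ + (σ/6) N(s)³`. -/
def qm (n : ℕ) (N : E n → ℝ) (f0 : ℝ) (g : E n) (H : E n →L[ℝ] E n) (σ : ℝ)
    (s : E n) : ℝ :=
  f0 + ⟪g, s⟫ + (1 / 2) * ⟪H s, s⟫ + σ / 6 * N s ^ 3

/-- The Hessian of `f` at `x`, as the Fréchet derivative of the gradient. -/
def hess (n : ℕ) (f : E n → ℝ) (x : E n) : E n →L[ℝ] E n :=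
  fderiv ℝ (gradient f) x

theorem IsNorm.nonneg {n : ℕ} {N : E n → ℝ} (hN : IsNorm n N) (x : E n) : 0 ≤ N x := by
  have h0 : N 0 = 0 := by simpa using hN.smul 0 0
  have hneg : N (-x) = N x := by simpa using hN.smul (-1) x
  have h := hN.add_le x (-x)
  rw [add_neg_cancel, h0, hneg] at h
  linarith

theorem abs_inner_apply_self_le {n : ℕ} (A : E n →L[ℝ] E n) {v : E n} (hv : ‖v‖ = 1) :
    |⟪A v, v⟫| ≤ ‖A‖ := by
  have h₁ := abs_real_inner_le_norm (A v) v
  have h₂ := A.le_opNorm v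
  rw [hv, mul_one] at h₁ h₂
  exact h₁.trans h₂

theorem lamMin_le_inner {n : ℕ} (A : E n →L[ℝ] E n) {v : E n} (hv : ‖v‖ = 1) :
    lamMin n A ≤ ⟪A v, v⟫ := by
  refine csInf_le ⟨-‖A‖, ?_⟩ ⟨v, hv, rfl⟩
  rintro _ ⟨w, hw, rfl⟩
  exact (abs_le.mp (abs_inner_apply_self_le A hw)).1

theorem lamMin_sub_norm_sub_le {n : ℕ} (hn : 1 ≤ n) (A B : E n →L[ℝ] E n) :
    lamMin n A - ‖B - A‖ ≤ lamMin n B := by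
  refine le_csInf ⟨_, EuclideanSpace.single ⟨0, hn⟩ 1, by simp, rfl⟩ ?_
  rintro _ ⟨v, hv, rfl⟩
  have h₁ := lamMin_le_inner A hv
  have h₂ := (abs_le.mp (abs_inner_apply_self_le (B - A) hv)).1
  rw [sub_apply, inner_sub_left] at h₂
  linarith

/-- lower bound on the step norm from second-order conditions:
 if `‖∇²f(x+s) − ∇²f(x)‖₂ ≤ L N(s)`, `λ_min[∇²f(x)] + θ₂ κ_ω σ N(s) ≥ 0` and
`λ_min[∇²f(x+s)] < −ε₂`, then `N(s) ≥ ε₂/(L + θ₂ κ_ω σmax)` where `κ_ω = 1 + 2/√3`. -/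
theorem stmt12 {n : ℕ} (hn : 1 ≤ n) (N : E n → ℝ) (hN : IsNorm n N)
    (f : E n → ℝ) (hf : ContDiff ℝ 2 f) (x s : E n)
    (L θ2 σ σmax ε2 : ℝ) (hL : 0 ≤ L) (hθ2 : 1 ≤ θ2)
    (hσ : 0 < σ) (hσmax : σ ≤ σmax) (hε2 : 0 < ε2)
    (hlip : ‖hess n f (x + s) - hess n f x‖ ≤ L * N s)
    (hcurv : 0 ≤ lamMin n (hess n f x) + θ2 * (1 + 2 / Real.sqrt 3) * σ * N s)
    (hneg : lamMin n (hess n f (x + s)) < -ε2) :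
    N s ≥ ε2 / (L + θ2 * (1 + 2 / Real.sqrt 3) * σmax) := by
  have hs := hN.nonneg s
  have hκ : 0 < θ2 * (1 + 2 / Real.sqrt 3) := by positivity
  have hpert := lamMin_sub_norm_sub_le hn (hess n f x) (hess n f (x + s))
  have hmono : θ2 * (1 + 2 / Real.sqrt 3) * σ * N s ≤ θ2 * (1 + 2 / Real.sqrt 3) * σmax * N s := by
    gcongr
  have hden : 0 < L + θ2 * (1 + 2 / Real.sqrt 3) * σmax :=
    add_pos_of_nonneg_of_pos hL (mul_pos hκ (hσ.trans_le hσmax))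
  rw [ge_iff_le, div_le_iff₀ hden]
  linarith
end
end

section
/- Suppose s ∈ ℝ^n and β ≥ 0 satisfy m(0) − m(s) ≥ β. Then N(s) ≤ ( (1/2)‖H‖_{N,2} + √( ‖H‖_{N,2}² + (2/3) σ ‖g‖_{N,1} ) ) / ( (1/3) σ ). Moreover, if β > 0 and λ_N[H] := min_{N(v)=1} ⟨Hv,v⟩, then N(s) ≥ ( √( ‖g‖_{N,1}² + 2β|λ_N[H]| ) − ‖g‖_{N,1} ) / |λ_N[H]| when λ_N[H] < 0, and N(s) ≥ β/‖g‖_{N,1} when λ_N[H] ≥ 0 (and g ≠ 0). -/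
open scoped RealInnerProductSpace

noncomputable section

/-- The most negative curvature of `H` in the norm `N`:
`λ_N[H] := min_{N v = 1} ⟪H v, v⟫`. -/
def lamN (n : ℕ) (N : E n → ℝ) (A : E n →L[ℝ] E n) : ℝ :=
  sInf {t : ℝ | ∃ v : E n, N v = 1 ∧ t = ⟪A v, v⟫}

namespace IsNorm

variable {n : ℕ} {N : E n → ℝ}

lemma map_zero (hN : IsNorm n N) : N 0 = 0 := by
  simpa using hN.smul 0 0

lemma nonneg_s16 (hN : IsNorm n N) (x : E n) : 0 ≤ N x := by
  have h := hN.add_le x ((-1 : ℝ) • x)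
  rw [hN.smul] at h
  have h0 : x + (-1 : ℝ) • x = 0 := by simp
  rw [h0, hN.map_zero] at h
  norm_num at h
  linarith

lemma pos (hN : IsNorm n N) {x : E n} (hx : x ≠ 0) : 0 < N x :=
  lt_of_le_of_ne (hN.nonneg_s16 x) fun h => hx (hN.eq_zero x h.symm)

lemma convexOn (hN : IsNorm n N) : ConvexOn ℝ Set.univ N := by
  refine ⟨convex_univ, fun x _ y _ a b ha hb _ => ?_⟩
  have h := hN.add_le (a • x) (b • y)
  rwa [hN.smul, hN.smul, abs_of_nonneg ha, abs_of_nonneg hb] at h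

lemma continuous (hN : IsNorm n N) : Continuous N :=
  continuousOn_univ.1 (hN.convexOn.continuousOn isOpen_univ)

/-- Every norm dominates a positive multiple of the Euclidean norm. -/
lemma exists_mul_norm_le (hN : IsNorm n N) : ∃ c : ℝ, 0 < c ∧ ∀ x, c * ‖x‖ ≤ N x := by
  rcases (Metric.sphere (0 : E n) 1).eq_empty_or_nonempty with he | hne
  · refine ⟨1, one_pos, fun x => ?_⟩
    by_cases hx : x = 0
    · simp [hx, hN.map_zero]
    · have hmem : (‖x‖⁻¹ • x) ∈ Metric.sphere (0 : E n) 1 := by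
        simp [norm_smul, hx]
      simp [he] at hmem
  · obtain ⟨u, hu, hmin⟩ :=
      (isCompact_sphere (0 : E n) 1).exists_isMinOn hne hN.continuous.continuousOn
    have hu0 : u ≠ 0 := by
      rintro rfl
      simp at hu
    refine ⟨N u, hN.pos hu0, fun x => ?_⟩
    by_cases hx : x = 0
    · simp [hx, hN.map_zero]
    · have hxpos : 0 < ‖x‖ := norm_pos_iff.2 hx
      have hmem : (‖x‖⁻¹ • x) ∈ Metric.sphere (0 : E n) 1 := by
        simp [norm_smul, hx]
      have h : N u ≤ N (‖x‖⁻¹ • x) := hmin hmem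
      rw [hN.smul, abs_of_pos (inv_pos.2 hxpos)] at h
      rwa [← le_div_iff₀ hxpos, div_eq_inv_mul]

lemma exists_norm_le (hN : IsNorm n N) : ∃ C : ℝ, ∀ x, N x = 1 → ‖x‖ ≤ C := by
  obtain ⟨c, hc, h⟩ := hN.exists_mul_norm_le
  refine ⟨1 / c, fun x hx => ?_⟩
  rw [le_div_iff₀ hc, mul_comm, ← hx]
  exact h x

lemma map_normalize (hN : IsNorm n N) {s : E n} (hs : s ≠ 0) : N ((N s)⁻¹ • s) = 1 := by
  have hpos := hN.pos hs
  rw [hN.smul, abs_of_pos (inv_pos.2 hpos), inv_mul_cancel₀ hpos.ne']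

lemma abs_inner_le_dualNorm_mul (hN : IsNorm n N) (v s : E n) :
    |⟪v, s⟫| ≤ dualNorm n N v * N s := by
  obtain ⟨C, hC⟩ := hN.exists_norm_le
  have hbdd : BddAbove {t : ℝ | ∃ s, N s = 1 ∧ t = ⟪v, s⟫} := by
    refine ⟨‖v‖ * C, ?_⟩
    rintro t ⟨x, hx, rfl⟩
    exact (real_inner_le_norm v x).trans
      (mul_le_mul_of_nonneg_left (hC x hx) (norm_nonneg v))
  have key : ∀ x, ⟪v, x⟫ ≤ dualNorm n N v * N x := by
    intro x
    by_cases hx : x = 0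
    · simp [hx, hN.map_zero]
    · have h : ⟪v, (N x)⁻¹ • x⟫ ≤ dualNorm n N v :=
        le_csSup hbdd ⟨_, hN.map_normalize hx, rfl⟩
      rwa [real_inner_smul_right, ← div_eq_inv_mul, div_le_iff₀ (hN.pos hx)] at h
  refine abs_le'.2 ⟨key s, ?_⟩
  have h := key ((-1 : ℝ) • s)
  rw [hN.smul] at h
  simpa using h

lemma exists_abs_inner_le (hN : IsNorm n N) (A : E n →L[ℝ] E n) :
    ∃ B : ℝ, ∀ x, N x = 1 → |⟪A x, x⟫| ≤ B := by
  obtain ⟨C, hC⟩ := hN.exists_norm_le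
  refine ⟨‖A‖ * C * C, fun x hx => ?_⟩
  have hx' := hC x hx
  have hC0 : 0 ≤ C := (norm_nonneg x).trans hx'
  calc |⟪A x, x⟫| ≤ ‖A x‖ * ‖x‖ := abs_real_inner_le_norm _ _
    _ ≤ (‖A‖ * ‖x‖) * ‖x‖ := by gcongr; exact A.le_opNorm x
    _ ≤ ‖A‖ * C * C := by gcongr

lemma inner_map_normalize (A : E n →L[ℝ] E n) (s : E n) :
    ⟪A ((N s)⁻¹ • s), (N s)⁻¹ • s⟫ = ⟪A s, s⟫ / N s ^ 2 := by
  rw [map_smul, real_inner_smul_left, real_inner_smul_right]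
  ring

lemma abs_inner_map_le_matNormN_mul (hN : IsNorm n N) (A : E n →L[ℝ] E n) (s : E n) :
    |⟪A s, s⟫| ≤ matNormN n N A * N s ^ 2 := by
  by_cases hs : s = 0
  · simp [hs, hN.map_zero]
  obtain ⟨B, hB⟩ := hN.exists_abs_inner_le A
  have hpos : 0 < N s ^ 2 := pow_pos (hN.pos hs) 2
  have h : |⟪A ((N s)⁻¹ • s), (N s)⁻¹ • s⟫| ≤ matNormN n N A := by
    refine le_csSup ⟨B, ?_⟩ ⟨_, hN.map_normalize hs, rfl⟩
    rintro t ⟨x, hx, rfl⟩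
    exact hB x hx
  rwa [inner_map_normalize, abs_div, abs_of_pos hpos, div_le_iff₀ hpos] at h

lemma lamN_mul_le_inner_map (hN : IsNorm n N) (A : E n →L[ℝ] E n) (s : E n) :
    lamN n N A * N s ^ 2 ≤ ⟪A s, s⟫ := by
  by_cases hs : s = 0
  · simp [hs, hN.map_zero]
  obtain ⟨B, hB⟩ := hN.exists_abs_inner_le A
  have hpos : 0 < N s ^ 2 := pow_pos (hN.pos hs) 2
  have h : lamN n N A ≤ ⟪A ((N s)⁻¹ • s), (N s)⁻¹ • s⟫ := by
    refine csInf_le ⟨-B, ?_⟩ ⟨_, hN.map_normalize hs, rfl⟩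
    rintro t ⟨x, hx, rfl⟩
    exact (abs_le.1 (hB x hx)).1
  rwa [inner_map_normalize, le_div_iff₀ hpos] at h

lemma dualNorm_nonneg (hN : IsNorm n N) (v : E n) : 0 ≤ dualNorm n N v := by
  by_cases hv : v = 0
  · refine Real.sSup_nonneg ?_
    rintro t ⟨x, -, rfl⟩
    simp [hv]
  · exact nonneg_of_mul_nonneg_left
      ((abs_nonneg _).trans (hN.abs_inner_le_dualNorm_mul v v)) (hN.pos hv)

end IsNorm

lemma matNormN_nonneg (n : ℕ) (N : E n → ℝ) (A : E n →L[ℝ] E n) : 0 ≤ matNormN n N A := by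
  refine Real.sSup_nonneg ?_
  rintro t ⟨x, -, rfl⟩
  exact abs_nonneg _

/-- upper and lower bounds on the step norm from a model decrease:
if `m(0) − m(s) ≥ β ≥ 0` then `N(s)` obeys the stated upper bound, and, if `β > 0`,
the stated lower bounds depending on the sign of `λ_N[H]`. -/
theorem stmt16 {n : ℕ} (hn : 1 ≤ n) (N : E n → ℝ) (hN : IsNorm n N)
    (f0 : ℝ) (g : E n) (H : E n →L[ℝ] E n)
    (hH : ∀ x y : E n, ⟪H x, y⟫ = ⟪x, H y⟫)
    (σ : ℝ) (hσ : 0 < σ) (s : E n) (β : ℝ) (hβ : 0 ≤ β)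
    (hdec : β ≤ qm n N f0 g H σ 0 - qm n N f0 g H σ s) :
    N s ≤ ((1 / 2) * matNormN n N H +
            Real.sqrt (matNormN n N H ^ 2 + (2 / 3) * σ * dualNorm n N g)) /
          ((1 / 3) * σ) ∧
      (0 < β →
        (lamN n N H < 0 →
          N s ≥ (Real.sqrt (dualNorm n N g ^ 2 + 2 * β * |lamN n N H|) -
              dualNorm n N g) / |lamN n N H|) ∧
        (0 ≤ lamN n N H → g ≠ 0 → N s ≥ β / dualNorm n N g)) := by
  have hG := hN.dualNorm_nonneg g
  have hM := matNormN_nonneg n N H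
  have hr := hN.nonneg_s16 s
  have hg := (abs_le.1 (hN.abs_inner_le_dualNorm_mul g s)).1
  have hHs := (abs_le.1 (hN.abs_inner_map_le_matNormN_mul H s)).1
  have hL := hN.lamN_mul_le_inner_map H s
  simp only [qm, inner_zero_right, hN.map_zero] at hdec
  have hrpos : 0 < β → 0 < N s := by
    intro hβ'
    refine hN.pos ?_
    rintro rfl
    simp [hN.map_zero] at hdec
    linarith
  generalize N s = r at *
  generalize dualNorm n N g = G at *
  generalize matNormN n N H = M at *
  generalize lamN n N H = L at *
  have hr3 : 0 ≤ σ / 6 * r ^ 3 := by positivity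
  have hlow : β ≤ G * r - 1 / 2 * (L * r ^ 2) := by linarith
  refine ⟨?_, fun hβ' => ⟨fun hneg => ?_, fun hpos _ => ?_⟩⟩
  · rw [le_div_iff₀ (by positivity)]
    suffices r * (1 / 3 * σ) - 1 / 2 * M ≤ √(M ^ 2 + 2 / 3 * σ * G) by linarith
    refine Real.le_sqrt_of_sq_le ?_
    rcases hr.eq_or_lt with rfl | hr0
    · have : 0 ≤ 2 / 3 * σ * G := by positivity
      nlinarith [sq_nonneg M]
    · have hcub : r * (σ / 6 * r ^ 2) ≤ r * (G + 1 / 2 * M * r) := by linarith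
      have hquad := mul_le_mul_of_nonneg_left (le_of_mul_le_mul_left hcub hr0) hσ.le
      nlinarith [sq_nonneg M]
  · rw [ge_iff_le, abs_of_neg hneg, div_le_iff₀ (by linarith), sub_le_iff_le_add]
    have hL0 : 0 ≤ r * -L := mul_nonneg hr (by linarith)
    refine Real.sqrt_le_iff.2 ⟨by linarith, ?_⟩
    nlinarith [mul_le_mul_of_nonneg_right hlow (neg_nonneg.2 hneg.le)]
  · have hGr : β ≤ G * r := by
      have : 0 ≤ L * r ^ 2 := by positivity
      linarith
    have hG0 : 0 < G := pos_of_mul_pos_left (hβ'.trans_le hGr) hr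
    rw [ge_iff_le, div_le_iff₀ hG0]
    linarith
end
end
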